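/- Let d ≥ 1, N ≥ 1, H ≥ 1, let L > 0 and η > 0 satisfy ηLH ≤ 1/100, let f_i : EuclideanSpace ℝ (Fin d) → ℝ for i = 1,…,N be differentiable functions whose gradients are L-Lipschitz, and set f = (1/N)∑_{i=1}^N f_i. Suppose f satisfies the gradient-domination condition: there exist θ* ∈ EuclideanSpace ℝ (Fin d) and μ with 0 < μ ≤ 2L such that f(θ*) ≤ f(θ) and μ(f(θ) − f(θ*)) ≤ ‖∇f(θ)‖² for all θ. Define the server iterates θ̄ : ℕ → EuclideanSpace ℝ (Fin d) recursively: given θ̄(t), set θ_{i,0} = θ̄(t), θ_{i,ℓ+1} = θ_{i,ℓ} − η(∇f_i(θ_{i,ℓ}) − ∇f_i(θ̄(t)) + ∇f(θ̄(t))) for ℓ = 0,…,H−1, and θ̄(t+1) = θ̄(t) + (1/N)∑_{i=1}^N (θ_{i,H} − θ̄(t)). Then for every T ≥ 0, f(θ̄(T)) − f(θ*) ≤ (1 − ηHμ/4)^T (f(θ̄(0)) − f(θ*)). -/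

import Mathlib

open InnerProductSpace in
theorem abs_sub_sub_inner_gradient_le {E : Type*} [NormedAddCommGroup E] [InnerProductSpace ℝ E]
    [CompleteSpace E] {f : E → ℝ} {L : ℝ} (hL : 0 ≤ L) (hf : Differentiable ℝ f)
    (hlip : ∀ x y, ‖gradient f x - gradient f y‖ ≤ L * ‖x - y‖) (x v : E) :
    |f (x + v) - f x - inner ℝ (gradient f x) v| ≤ L * ‖v‖ ^ 2 := by
  have key := (convex_closedBall x ‖v‖).norm_image_sub_le_of_norm_hasFDerivWithin_le'
    (f := f) (f' := fun y => toDual ℝ E (gradient f y)) (φ := toDual ℝ E (gradient f x))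
    (C := L * ‖v‖) (x := x) (y := x + v)
    (fun y _ => (hf y).hasGradientAt.hasFDerivAt.hasFDerivWithinAt)
    (fun y hy => by
      rw [← map_sub, LinearIsometryEquiv.norm_map]
      refine (hlip y x).trans (mul_le_mul_of_nonneg_left ?_ hL)
      rwa [← dist_eq_norm])
    (by simp) (by simp)
  rw [add_sub_cancel_left, toDual_apply_apply, Real.norm_eq_abs] at key
  linarith [sq ‖v‖, mul_assoc L ‖v‖ ‖v‖]

theorem hasGradientAt_const_mul_sum {E : Type*} [NormedAddCommGroup E] [InnerProductSpace ℝ E]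
    [CompleteSpace E] {ι : Type*} [Fintype ι] {f : ι → E → ℝ} (hf : ∀ i, Differentiable ℝ (f i))
    (c : ℝ) {g : E → ℝ} (hg : ∀ x, g x = c * ∑ i, f i x) (x : E) :
    HasGradientAt g (c • ∑ i, gradient (f i) x) x := by
  rw [funext hg, hasGradientAt_iff_hasFDerivAt]
  have h := (HasFDerivAt.fun_sum (u := Finset.univ)
    fun i _ => (hf i x).hasGradientAt.hasFDerivAt).const_mul c
  simpa using h

theorem norm_average_le {E : Type*} [NormedAddCommGroup E] [NormedSpace ℝ E] {N : ℕ}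
    (hN : 1 ≤ N) {u : Fin N → E} {C : ℝ} (hu : ∀ i, ‖u i‖ ≤ C) :
    ‖(1 / (N : ℝ)) • ∑ i, u i‖ ≤ C := by
  have hN' : (0 : ℝ) < N := by exact_mod_cast hN
  have h : ‖∑ i, u i‖ ≤ N * C := by
    simpa using norm_sum_le_of_le Finset.univ fun i _ => hu i
  rw [norm_smul, Real.norm_of_nonneg (by positivity), one_div, inv_mul_le_iff₀ hN']
  exact h

/-- Drift-corrected local steps stay close to the corresponding plain gradient steps. -/
theorem norm_local_drift_le {E : Type*} [NormedAddCommGroup E] [NormedSpace ℝ E] {H : ℕ}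
    {L η : ℝ} (hL : 0 ≤ L) (hη : 0 ≤ η) (hstep : η * L * H ≤ 1 / 100) {F : E → E}
    (hF : ∀ x y, ‖F x - F y‖ ≤ L * ‖x - y‖) {x g : E} {u : ℕ → E} (hu0 : u 0 = x)
    (hu : ∀ l, u (l + 1) = u l - η • (F (u l) - F x + g)) {l : ℕ} (hl : l ≤ H) :
    ‖u l - x + ((l : ℝ) * η) • g‖ ≤ 2 * (η * L * H) * (l * η * ‖g‖) := by
  induction l with
  | zero => simp [hu0]
  | succ l ih =>
    have ih := ih (by omega)
    have hlH : (l : ℝ) ≤ H := by exact_mod_cast (by omega : l ≤ H)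
    have hB : (l : ℝ) * η * ‖g‖ ≤ H * η * ‖g‖ := by gcongr
    have hB0 : 0 ≤ (l : ℝ) * η * ‖g‖ := by positivity
    have hdist : ‖u l - x‖ ≤ 2 * (H * η * ‖g‖) := by
      have h1 := norm_sub_le (u l - x + ((l : ℝ) * η) • g) (((l : ℝ) * η) • g)
      rw [add_sub_cancel_right, norm_smul _ g, Real.norm_of_nonneg (by positivity)] at h1
      nlinarith [mul_le_mul_of_nonneg_right hstep hB0]
    have hsplit : u (l + 1) - x + (((l + 1 : ℕ) : ℝ) * η) • g =
        (u l - x + ((l : ℝ) * η) • g) - η • (F (u l) - F x) := by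
      rw [hu]; push_cast; module
    calc ‖u (l + 1) - x + (((l + 1 : ℕ) : ℝ) * η) • g‖
        ≤ ‖u l - x + ((l : ℝ) * η) • g‖ + η * ‖F (u l) - F x‖ := by
          rw [hsplit]
          refine (norm_sub_le _ _).trans_eq ?_
          rw [norm_smul, Real.norm_of_nonneg hη]
      _ ≤ 2 * (η * L * H) * (l * η * ‖g‖) + η * (L * (2 * (H * η * ‖g‖))) := by
          gcongr
          exact (hF _ _).trans (by gcongr)
      _ = 2 * (η * L * H) * ((l + 1 : ℕ) * η * ‖g‖) := by push_cast; ring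

/-- Sufficient decrease for a gradient step with a small relative error. -/
theorem le_sub_of_inexact_gradient_step {E : Type*} [NormedAddCommGroup E]
    [InnerProductSpace ℝ E] [CompleteSpace E] {f : E → ℝ} {L a : ℝ} (hL : 0 ≤ L)
    (ha : 0 ≤ a) (haL : a * L ≤ 1 / 100) (hf : Differentiable ℝ f)
    (hlip : ∀ x y, ‖gradient f x - gradient f y‖ ≤ L * ‖x - y‖) {x r : E}
    (hr : ‖r‖ ≤ 1 / 50 * (a * ‖gradient f x‖)) :
    f (x + (r - a • gradient f x)) ≤ f x - a / 4 * ‖gradient f x‖ ^ 2 := by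
  have hd := (abs_le.1 (abs_sub_sub_inner_gradient_le hL hf hlip x (r - a • gradient f x))).2
  rw [inner_sub_right, inner_smul_right, real_inner_self_eq_norm_sq] at hd
  set g := gradient f x
  have hG : 0 ≤ ‖g‖ := norm_nonneg g
  have hin : inner ℝ g r ≤ 1 / 50 * (a * ‖g‖ ^ 2) :=
    (real_inner_le_norm g r).trans (by nlinarith)
  have hv : ‖r - a • g‖ ≤ 2 * (a * ‖g‖) := by
    have h := norm_sub_le r (a • g)
    rw [norm_smul, Real.norm_of_nonneg ha] at h
    nlinarith [mul_nonneg ha hG]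
  have hv2 : L * ‖r - a • g‖ ^ 2 ≤ L * (2 * (a * ‖g‖)) ^ 2 := by gcongr
  have haG : 0 ≤ a * ‖g‖ ^ 2 := by positivity
  nlinarith [mul_le_mul_of_nonneg_right haL haG]

theorem stmt_9 {d N H : ℕ} (hd : 1 ≤ d) (hN : 1 ≤ N) (hH : 1 ≤ H)
    (L η : ℝ) (hL : 0 < L) (hη : 0 < η) (hstep : η * L * H ≤ 1 / 100)
    (f : Fin N → EuclideanSpace ℝ (Fin d) → ℝ)
    (hdiff : ∀ i, Differentiable ℝ (f i))
    (hlip : ∀ i x y, ‖gradient (f i) x - gradient (f i) y‖ ≤ L * ‖x - y‖)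
    (favg : EuclideanSpace ℝ (Fin d) → ℝ)
    (hfavg : ∀ x, favg x = (1 / (N : ℝ)) * ∑ i, f i x)
    (θstar : EuclideanSpace ℝ (Fin d)) (μ : ℝ) (hμ0 : 0 < μ) (hμL : μ ≤ 2 * L)
    (hopt : ∀ θ, favg θstar ≤ favg θ)
    (hgd : ∀ θ, μ * (favg θ - favg θstar) ≤ ‖gradient favg θ‖ ^ 2)
    (θbar : ℕ → EuclideanSpace ℝ (Fin d))
    (θ : ℕ → Fin N → ℕ → EuclideanSpace ℝ (Fin d))
    (hθ0 : ∀ t i, θ t i 0 = θbar t)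
    (hθ : ∀ t i ℓ, θ t i (ℓ + 1) = θ t i ℓ -
      η • (gradient (f i) (θ t i ℓ) - gradient (f i) (θbar t) + gradient favg (θbar t)))
    (hserv : ∀ t, θbar (t + 1) = θbar t + (1 / (N : ℝ)) • ∑ i, (θ t i H - θbar t)) :
    ∀ T : ℕ, favg (θbar T) - favg θstar ≤
      (1 - η * H * μ / 4) ^ T * (favg (θbar 0) - favg θstar) := by
  have hN0 : (N : ℝ) ≠ 0 := by positivity
  have hgrad := hasGradientAt_const_mul_sum hdiff (1 / (N : ℝ)) hfavg
  have hfavg_diff : Differentiable ℝ favg := fun x => (hgrad x).hasFDerivAt.differentiableAt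
  have hfavg_lip : ∀ x y, ‖gradient favg x - gradient favg y‖ ≤ L * ‖x - y‖ := fun x y => by
    rw [(hgrad x).gradient, (hgrad y).gradient, ← smul_sub, ← Finset.sum_sub_distrib]
    exact norm_average_le hN fun i => hlip i x y
  have ha : 0 ≤ η * H := by positivity
  have haL : η * H * L ≤ 1 / 100 := by linarith [mul_right_comm η L (H : ℝ)]
  have hdecr (t : ℕ) : favg (θbar (t + 1)) ≤
      favg (θbar t) - η * H / 4 * ‖gradient favg (θbar t)‖ ^ 2 := by
    set g := gradient favg (θbar t) with hg
    have hr (i : Fin N) : ‖θ t i H - θbar t + ((H : ℝ) * η) • g‖ ≤ 1 / 50 * (η * H * ‖g‖) := by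
      have h := norm_local_drift_le hL.le hη.le hstep (hlip i) (hθ0 t i) (hθ t i) le_rfl
      rw [← hg] at h
      linarith [mul_le_mul_of_nonneg_right hstep (mul_nonneg ha (norm_nonneg g)),
        mul_comm (H : ℝ) η]
    have hupd : θbar (t + 1) = θbar t + ((1 / (N : ℝ)) •
        ∑ i, (θ t i H - θbar t + ((H : ℝ) * η) • g) - (η * H) • g) := by
      rw [hserv, Finset.sum_add_distrib, Finset.sum_const, Finset.card_univ, Fintype.card_fin,
        ← Nat.cast_smul_eq_nsmul ℝ, smul_add, smul_smul (1 / (N : ℝ)), one_div_mul_cancel hN0,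
        one_smul, mul_comm (H : ℝ), add_sub_cancel_right]
    rw [hupd]
    exact le_sub_of_inexact_gradient_step hL.le ha haL hfavg_diff hfavg_lip
      (norm_average_le hN hr)
  have hrate : 0 ≤ 1 - η * H * μ / 4 := by nlinarith [mul_le_mul_of_nonneg_left hμL ha]
  intro T
  induction T with
  | zero => simp
  | succ t ih =>
    calc favg (θbar (t + 1)) - favg θstar
        ≤ (1 - η * H * μ / 4) * (favg (θbar t) - favg θstar) := by
          nlinarith [hdecr t, mul_le_mul_of_nonneg_left (hgd (θbar t)) ha]
      _ ≤ (1 - η * H * μ / 4) *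
            ((1 - η * H * μ / 4) ^ t * (favg (θbar 0) - favg θstar)) := by gcongr
      _ = _ := by ring
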